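/- In the switched-feedback setup, Z is almost surely a function of (X1, X2, Yd) (so H(Z | X1, X2, Yd) = 0), and the following identity holds: I(X2, Yd ; Z) + I(X1 ; Yd, Z | X2) + I(X2 ; Yd) − H(Z) = I(X1, X2 ; Yd) = p · I(X1, X2 ; Y). -/

import Mathlib

open MeasureTheory

namespace SF

variable {Ω : Type*} [MeasurableSpace Ω]

/-- The probability that a random variable `X` takes the value `a`. -/
noncomputable def pr (μ : Measure Ω) {A : Type*} (X : Ω → A) (a : A) : ℝ :=
  (μ (X ⁻¹' {a})).toReal

/-- Shannon entropy (natural logarithm) of a finite-valued random variable. -/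
noncomputable def ent (μ : Measure Ω) {A : Type*} [Fintype A] (X : Ω → A) : ℝ :=
  ∑ a, Real.negMulLog (pr μ X a)

/-- Conditional entropy `H(X | Y)`. -/
noncomputable def condEnt (μ : Measure Ω) {A B : Type*} [Fintype A] [Fintype B]
    (X : Ω → A) (Y : Ω → B) : ℝ :=
  ent μ (fun ω => (X ω, Y ω)) - ent μ Y

/-- Mutual information `I(X ; Y)`. -/
noncomputable def mi (μ : Measure Ω) {A B : Type*} [Fintype A] [Fintype B]
    (X : Ω → A) (Y : Ω → B) : ℝ :=
  ent μ X + ent μ Y - ent μ (fun ω => (X ω, Y ω))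

/-- Conditional mutual information `I(X ; Y | Z)`. -/
noncomputable def cmi (μ : Measure Ω) {A B C : Type*} [Fintype A] [Fintype B] [Fintype C]
    (X : Ω → A) (Y : Ω → B) (Z : Ω → C) : ℝ :=
  ent μ (fun ω => (X ω, Z ω)) + ent μ (fun ω => (Y ω, Z ω))
    - ent μ (fun ω => (X ω, Y ω, Z ω)) - ent μ Z

end SF

open SF MeasureTheory

namespace SF

section Helpers

variable {Ω : Type*} [MeasurableSpace Ω] {μ : Measure Ω}

/-- Entropy is invariant under injective relabelling of the values. -/
theorem ent_of_injective {A B : Type*} [Fintype A] [Fintype B] {f : A → B}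
    (hf : Function.Injective f) (X : Ω → A) {W : Ω → B} (hW : ∀ ω, W ω = f (X ω)) :
    ent μ W = ent μ X := by
  classical
  obtain rfl : W = fun ω => f (X ω) := funext hW
  have hpr : ∀ a, pr μ (fun ω => f (X ω)) (f a) = pr μ X a := fun a => by
    unfold pr
    congr 2
    ext ω
    simp [hf.eq_iff]
  unfold ent
  rw [← Finset.sum_subset (Finset.subset_univ (Finset.univ.image f)),
    Finset.sum_image fun _ _ _ _ h => hf h]
  · simp only [hpr]
  · intro b _ hb
    have hempty : (fun ω => f (X ω)) ⁻¹' {b} = ∅ := by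
      ext ω
      simp only [Set.mem_preimage, Set.mem_singleton_iff, Set.mem_empty_iff_false, iff_false]
      exact fun h => hb (Finset.mem_image.2 ⟨X ω, Finset.mem_univ _, h⟩)
    simp [pr, hempty]

theorem measurableSet_preimage_of_atoms {A : Type*} [Finite A] {X : Ω → A}
    (hX : ∀ a, MeasurableSet (X ⁻¹' {a})) (s : Set A) : MeasurableSet (X ⁻¹' s) := by
  rw [← Set.biUnion_preimage_singleton]
  exact MeasurableSet.biUnion s.to_countable fun a _ => hX a

/-- The probability of an event determined by `X` is the sum of the probabilities of its atoms. -/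
theorem measure_preimage_eq_sum_pr [IsFiniteMeasure μ] {A : Type*} {X : Ω → A}
    (hX : ∀ a, MeasurableSet (X ⁻¹' {a})) (s : Finset A) :
    (μ (X ⁻¹' s)).toReal = ∑ a ∈ s, pr μ X a := by
  rw [← Set.biUnion_preimage_singleton]
  exact measureReal_biUnion_finset
    (fun a _ b _ hab => Disjoint.preimage X (Set.disjoint_singleton.2 hab)) fun a _ => hX a

theorem sum_pr_eq_one [IsProbabilityMeasure μ] {A : Type*} [Fintype A] {X : Ω → A}
    (hX : ∀ a, MeasurableSet (X ⁻¹' {a})) : ∑ a, pr μ X a = 1 := by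
  rw [← measure_preimage_eq_sum_pr hX]
  simp

/-- Independence of `V` and `T`, given on atoms, passes to functions of `T`. -/
theorem pr_prod_comp_of_indep [IsFiniteMeasure μ] {A B C : Type*} [Fintype A]
    {V : Ω → C} {T : Ω → A} (hVT : ∀ c, MeasurableSet ((fun ω => (V ω, T ω)) ⁻¹' {c}))
    (hT : ∀ a, MeasurableSet (T ⁻¹' {a}))
    (hindep : ∀ v a, pr μ (fun ω => (V ω, T ω)) (v, a) = pr μ V v * pr μ T a)
    (f : A → B) (v : C) (b : B) :
    pr μ (fun ω => (V ω, f (T ω))) (v, b) = pr μ V v * pr μ (fun ω => f (T ω)) b := by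
  classical
  have h₁ : (fun ω => (V ω, f (T ω))) ⁻¹' {(v, b)} = (fun ω => (V ω, T ω)) ⁻¹'
      (({v} ×ˢ Finset.univ.filter (f · = b) : Finset (C × A)) : Set (C × A)) := by
    ext ω
    simp [and_comm, eq_comm]
  have h₂ : (fun ω => f (T ω)) ⁻¹' {b}
      = T ⁻¹' ((Finset.univ.filter (f · = b) : Finset A) : Set A) := by
    ext ω
    simp
  have hf : pr μ (fun ω => f (T ω)) b = ∑ a with f a = b, pr μ T a := by
    rw [pr, h₂, measure_preimage_eq_sum_pr hT]
  rw [pr, h₁, measure_preimage_eq_sum_pr hVT, hf, Finset.sum_product, Finset.sum_singleton, Finset.mul_sum]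
  exact Finset.sum_congr rfl fun a _ => hindep v a

theorem sum_negMulLog_mul {A : Type*} [Fintype A] (c : ℝ) {q : A → ℝ} (hq : ∑ a, q a = 1) :
    ∑ a, Real.negMulLog (c * q a) = Real.negMulLog c + c * ∑ a, Real.negMulLog (q a) := by
  simp only [Real.negMulLog_mul, Finset.sum_add_distrib, ← Finset.sum_mul, ← Finset.mul_sum, hq,
    one_mul]

/-- Entropy of a disjoint mixture of `U` and `W` selected by an independent switch `V`. -/
theorem ent_switch [IsProbabilityMeasure μ] {A B : Type*} [Fintype A] [Fintype B]
    {V : Ω → Bool} {U : Ω → A} {W : Ω → B}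
    (hU : ∀ a, MeasurableSet (U ⁻¹' {a})) (hW : ∀ b, MeasurableSet (W ⁻¹' {b}))
    (hVU : ∀ v a, pr μ (fun ω => (V ω, U ω)) (v, a) = pr μ V v * pr μ U a)
    (hVW : ∀ v b, pr μ (fun ω => (V ω, W ω)) (v, b) = pr μ V v * pr μ W b) :
    ent μ (fun ω => if V ω then Sum.inl (U ω) else (Sum.inr (W ω) : A ⊕ B))
      = ent μ V + pr μ V true * ent μ U + pr μ V false * ent μ W := by
  have hl : ∀ a, pr μ (fun ω => if V ω then Sum.inl (U ω) else (Sum.inr (W ω) : A ⊕ B))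
      (Sum.inl a) = pr μ V true * pr μ U a := fun a => by
    rw [← hVU]
    unfold pr
    congr 2
    ext ω
    cases h : V ω <;> simp [h]
  have hr : ∀ b, pr μ (fun ω => if V ω then Sum.inl (U ω) else (Sum.inr (W ω) : A ⊕ B))
      (Sum.inr b) = pr μ V false * pr μ W b := fun b => by
    rw [← hVW]
    unfold pr
    congr 2
    ext ω
    cases h : V ω <;> simp [h]
  simp only [ent, Fintype.sum_sum_type, hl, hr, sum_negMulLog_mul _ (sum_pr_eq_one hU),
    sum_negMulLog_mul _ (sum_pr_eq_one hW), Fintype.sum_bool]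
  ring

theorem ent_const_unit [IsProbabilityMeasure μ] : ent μ (fun _ => ()) = 0 := by
  simp [ent, pr]

/-- Erasing `Y` with an independent switch scales its mutual information with `X`. -/
theorem mi_erasure [IsProbabilityMeasure μ] {A B : Type*} [Fintype A] [Fintype B]
    {V : Ω → Bool} {X : Ω → A} {Y : Ω → B}
    (hmeas : ∀ c, MeasurableSet ((fun ω => (V ω, X ω, Y ω)) ⁻¹' {c}))
    (hindep : ∀ v c, pr μ (fun ω => (V ω, X ω, Y ω)) (v, c)
      = pr μ V v * pr μ (fun ω => (X ω, Y ω)) c) :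
    mi μ X (fun ω => if V ω then some (Y ω) else none) = pr μ V true * mi μ X Y := by
  have hV : ∀ v, MeasurableSet (V ⁻¹' {v}) := fun v =>
    measurableSet_preimage_of_atoms hmeas (Prod.fst ⁻¹' {v})
  have hXY : ∀ c, MeasurableSet ((fun ω => (X ω, Y ω)) ⁻¹' {c}) := fun c =>
    measurableSet_preimage_of_atoms hmeas (Prod.snd ⁻¹' {c})
  have hX : ∀ a, MeasurableSet (X ⁻¹' {a}) := fun a =>
    measurableSet_preimage_of_atoms hXY (Prod.fst ⁻¹' {a})
  have hY : ∀ b, MeasurableSet (Y ⁻¹' {b}) := fun b =>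
    measurableSet_preimage_of_atoms hXY (Prod.snd ⁻¹' {b})
  have hsum : pr μ V true + pr μ V false = 1 := by
    rw [← sum_pr_eq_one (μ := μ) hV, Fintype.sum_bool]
  have hYd : ent μ (fun ω => if V ω then some (Y ω) else none)
      = ent μ V + pr μ V true * ent μ Y := by
    have h := ent_switch (μ := μ) (V := V) (W := fun _ => ()) hY (fun _ => .const _)
      (pr_prod_comp_of_indep hmeas hXY hindep Prod.snd)
      (pr_prod_comp_of_indep hmeas hXY hindep fun _ => ())
    rw [ent_const_unit, mul_zero, add_zero] at h
    rw [← h]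
    refine (ent_of_injective (Equiv.optionEquivSumPUnit B).injective _ fun ω => ?_).symm
    cases V ω <;> simp
  have hXYd : ent μ (fun ω => (X ω, if V ω then some (Y ω) else none))
      = ent μ V + pr μ V true * ent μ (fun ω => (X ω, Y ω)) + pr μ V false * ent μ X := by
    rw [← ent_switch hXY hX hindep (pr_prod_comp_of_indep hmeas hXY hindep Prod.fst)]
    refine ent_of_injective (f := Sum.elim (fun c : A × B => (c.1, some c.2)) fun a => (a, none))
      ?_ _ fun ω => ?_
    · rintro (⟨a, b⟩ | a) (⟨a', b'⟩ | a') h <;> simp_all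
    · cases V ω <;> simp
  unfold mi
  rw [hYd, hXYd]
  linear_combination (-ent μ X) * hsum

end Helpers

end SF

/-- In the switched-feedback setup (`Yd = Y` if `V = 1`, else `e`;
`Z = (X1,X2)` if `V = 0`, else `e`; `V ~ Bernoulli(p)` independent of `(X1,X2,Y)`;
`e` modelled by `none`): `Z` is a function of `(X1,X2,Yd)`, i.e.
`H(Z | X1, X2, Yd) = 0`, and
`I(X2,Yd ; Z) + I(X1 ; Yd,Z | X2) + I(X2 ; Yd) − H(Z) = I(X1,X2 ; Yd) = p·I(X1,X2 ; Y)`. -/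
theorem statement10 {Ω : Type*} [MeasurableSpace Ω] (μ : Measure Ω) [IsProbabilityMeasure μ]
    {A1 A2 AY : Type*} [Fintype A1] [Fintype A2] [Fintype AY]
    (X1 : Ω → A1) (X2 : Ω → A2) (Y : Ω → AY) (V : Ω → Bool)
    (p : ℝ) (hp0 : 0 ≤ p) (hp1 : p ≤ 1)
    (hp : pr μ V true = p)
    (hmeas : ∀ (a : A1) (b : A2) (y : AY) (v : Bool),
      MeasurableSet ((fun ω => (X1 ω, X2 ω, Y ω, V ω)) ⁻¹' {(a, b, y, v)}))
    (hindep : ∀ (v : Bool) (a : A1) (b : A2) (y : AY),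
      pr μ (fun ω => (V ω, X1 ω, X2 ω, Y ω)) (v, a, b, y)
        = pr μ V v * pr μ (fun ω => (X1 ω, X2 ω, Y ω)) (a, b, y)) :
    condEnt μ (fun ω => if V ω then none else some (X1 ω, X2 ω))
        (fun ω => (X1 ω, X2 ω, if V ω then some (Y ω) else none)) = 0
    ∧ mi μ (fun ω => (X2 ω, if V ω then some (Y ω) else none))
          (fun ω => if V ω then none else some (X1 ω, X2 ω))
        + cmi μ X1
            (fun ω => ((if V ω then some (Y ω) else none),
                       (if V ω then none else some (X1 ω, X2 ω)))) X2
        + mi μ X2 (fun ω => if V ω then some (Y ω) else none)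
        - ent μ (fun ω => if V ω then none else some (X1 ω, X2 ω))
      = mi μ (fun ω => (X1 ω, X2 ω)) (fun ω => if V ω then some (Y ω) else none)
    ∧ mi μ (fun ω => (X1 ω, X2 ω)) (fun ω => if V ω then some (Y ω) else none)
      = p * mi μ (fun ω => (X1 ω, X2 ω)) Y := by
  have hZ : ent μ (fun ω => (X1 ω, ((if V ω then some (Y ω) else none),
        (if V ω then none else some (X1 ω, X2 ω))), X2 ω))
      = ent μ (fun ω => (X1 ω, X2 ω, if V ω then some (Y ω) else none)) := by
    refine ent_of_injective (f := fun t : A1 × A2 × Option AY =>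
      (t.1, (t.2.2, if t.2.2.isSome then none else some (t.1, t.2.1)), t.2.1)) ?_ _ fun ω => ?_
    · rintro ⟨a, b, y⟩ ⟨a', b', y'⟩ h
      simp_all
    · cases V ω <;> simp
  refine ⟨?_, ?_, ?_⟩
  · rw [condEnt, sub_eq_zero]
    refine ent_of_injective (f := fun t : A1 × A2 × Option AY =>
      (if t.2.2.isSome then none else some (t.1, t.2.1), t)) ?_ _ fun ω => ?_
    · exact fun _ _ h => congrArg Prod.snd h
    · cases V ω <;> simp
  · have h₁ : ent μ (fun ω => (((if V ω then some (Y ω) else none),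
          (if V ω then none else some (X1 ω, X2 ω))), X2 ω))
        = ent μ (fun ω => ((X2 ω, if V ω then some (Y ω) else none),
          (if V ω then none else some (X1 ω, X2 ω)))) := by
      refine ent_of_injective (f := fun t : (A2 × Option AY) × Option (A1 × A2) =>
        ((t.1.2, t.2), t.1.1)) ?_ _ fun ω => rfl
      rintro ⟨⟨b, y⟩, z⟩ ⟨⟨b', y'⟩, z'⟩ h
      simp_all
    have h₂ : ent μ (fun ω => ((X1 ω, X2 ω), if V ω then some (Y ω) else none))
        = ent μ (fun ω => (X1 ω, X2 ω, if V ω then some (Y ω) else none)) :=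
      ent_of_injective (Equiv.prodAssoc A1 A2 (Option AY)).symm.injective _ fun ω => rfl
    simp only [mi, cmi, hZ, h₁, h₂]
    ring
  · have hatoms : ∀ c, MeasurableSet ((fun ω => (X1 ω, X2 ω, Y ω, V ω)) ⁻¹' {c}) :=
      fun ⟨a, b, y, v⟩ => hmeas a b y v
    rw [← hp]
    refine mi_erasure (fun c => measurableSet_preimage_of_atoms hatoms
      ((fun t => (t.2.2.2, (t.1, t.2.1), t.2.2.1)) ⁻¹' {c})) ?_
    rintro v ⟨⟨a, b⟩, y⟩
    convert hindep v a b y using 1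
    · unfold pr
      congr 2
      ext ω
      simp [and_assoc]
    · unfold pr
      congr 3
      ext ω
      simp [and_assoc]
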